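/- Let 𝒯=(V,ℰ) be a leafless, locally finite rooted directed tree, let q be a positive integer, let S_{λ,q} be the Dirichlet shift on ℓ²(V), and let S'_{λ,q} = S_{λ,q}(S_{λ,q}*S_{λ,q})^{-1} be its Cauchy dual. Then S'_{λ,q} is subnormal: there exist a complex Hilbert space K, a linear isometry J : ℓ²(V) → K, and a bounded normal operator N on K such that N ∘ J = J ∘ S'_{λ,q}. -/

import Mathlib

open scoped ENNReal InnerProductSpace
open ContinuousLinearMap

noncomputable section

/-- A (countably infinite) rooted directed tree. -/
structure DirTree (V : Type) where
  edge : V → V → Prop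
  not_self : ∀ v, ¬ edge v v
  no_circuit : ∀ v, ¬ Relation.TransGen edge v v
  connected : ∀ u v : V, Relation.ReflTransGen (fun a b => edge a b ∨ edge b a) u v
  uniq_parent : ∀ {u w v : V}, edge u v → edge w v → u = w
  root : V
  root_no_parent : ∀ u, ¬ edge u root
  root_uniq : ∀ v, (∀ u, ¬ edge u v) → v = root

namespace DirTree

variable {V : Type} (T : DirTree V)

/-- The set of children of a vertex. -/
def chi (v : V) : Set V := {u | T.edge v u}

/-- Leafless: every vertex has a child. -/
def Leafless : Prop := ∀ v : V, ∃ u, T.edge v u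

/-- Locally finite: every vertex has finitely many children. -/
def LocFin : Prop := ∀ v : V, (T.chi v).Finite

/-- The finset of children of a vertex (locally finite case). -/
def chiFin (hT : T.LocFin) (v : V) : Finset V := (hT v).toFinset

/-- Iterated child sets `Chi^⟨n⟩(W)`. -/
def chiIter (T : DirTree V) : ℕ → Set V → Set V
  | 0, W => W
  | n + 1, W => {u | ∃ v ∈ chiIter T n W, T.edge v u}

/-- The depth of a vertex: the unique `n` with `v ∈ Chi^⟨n⟩(root)`. -/
def depth (v : V) : ℕ := sInf {n | v ∈ T.chiIter n {T.root}}

/-- The parent map (junk value at the root). -/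
def par (v : V) : V :=
  letI := Classical.propDecidable (∃ u, T.edge u v)
  if h : ∃ u, T.edge u v then h.choose else v

end DirTree

/-- `ℓ²(V)`. -/
abbrev l2 (V : Type) := lp (fun _ : V => ℂ) 2

/-- The standard orthonormal basis vector `e_v` of `ℓ²(V)`. -/
def evec {V : Type} (v : V) : l2 V :=
  letI := Classical.decEq V
  lp.single 2 v 1

/-- The Pochhammer symbol `(x)_k = x (x+1) ⋯ (x+k-1)`. -/
def poch (x : ℝ) (k : ℕ) : ℝ := ∏ i ∈ Finset.range k, (x + i)

namespace DirTree

variable {V : Type} (T : DirTree V)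

/-- The weight `λ_{u,q}` (for any child `u` of `v`). -/
def wt (hT : T.LocFin) (q : ℝ) (v : V) : ℝ :=
  Real.sqrt (((T.depth v : ℝ) + q) / ((T.depth v : ℝ) + 1)) /
    Real.sqrt ((T.chiFin hT v).card)

/-- `S` is the Dirichlet shift with parameter `q` on `ℓ²(V)`:
`S e_v = ∑_{u ∈ Chi(v)} λ_{u,q} e_u`. -/
def IsDirichletShift (hT : T.LocFin) (q : ℝ) (S : l2 V →L[ℂ] l2 V) : Prop :=
  ∀ v : V, S (evec v) = ∑ u ∈ T.chiFin hT v, ((T.wt hT q v : ℝ) : ℂ) • evec u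

end DirTree

/-- The Cauchy dual `S (S*S)⁻¹` of a left-invertible operator. -/
def cauchyDual {V : Type} (S : l2 V →L[ℂ] l2 V) : l2 V →L[ℂ] l2 V :=
  S * Ring.inverse (ContinuousLinearMap.adjoint S * S)

section Normal

open MeasureTheory

/-- Every isometry of a Hilbert space extends to a unitary (in particular normal) operator. -/
theorem LinearIsometry.exists_normal_extension {H : Type*} [NormedAddCommGroup H]
    [InnerProductSpace ℂ H] [CompleteSpace H] (U : H →ₗᵢ[ℂ] H) :
    ∃ A : WithLp 2 (H × H) →L[ℂ] WithLp 2 (H × H),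
      adjoint A * A = A * adjoint A ∧
        ∀ x, A (WithLp.toLp 2 (x, 0)) = WithLp.toLp 2 (U x, 0) := by
  set W : H →L[ℂ] H := U.toContinuousLinearMap with hW
  have hUU (x : H) : adjoint W (W x) = x := by
    refine ext_inner_right ℂ fun y => ?_
    rw [adjoint_inner_left]
    exact U.inner_map_map x y
  let e := WithLp.prodContinuousLinearEquiv 2 ℂ H H
  let p₁ : WithLp 2 (H × H) →L[ℂ] H := fst ℂ H H ∘L e.toContinuousLinearMap
  let p₂ : WithLp 2 (H × H) →L[ℂ] H := snd ℂ H H ∘L e.toContinuousLinearMap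
  let A : WithLp 2 (H × H) →L[ℂ] WithLp 2 (H × H) := e.symm.toContinuousLinearMap ∘L
    (W ∘L p₁ + (p₂ - W ∘L adjoint W ∘L p₂)).prod (adjoint W ∘L p₂)
  let B : WithLp 2 (H × H) →L[ℂ] WithLp 2 (H × H) := e.symm.toContinuousLinearMap ∘L
    (adjoint W ∘L p₁).prod (p₁ - W ∘L adjoint W ∘L p₁ + W ∘L p₂)
  have hA (z) : A z = WithLp.toLp 2
    (W z.fst + (z.snd - W (adjoint W z.snd)), adjoint W z.snd) := rfl
  have hB (z) : B z = WithLp.toLp 2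
    (adjoint W z.fst, z.fst - W (adjoint W z.fst) + W z.snd) := rfl
  have hAB : B = adjoint A := by
    rw [eq_adjoint_iff]
    intro x y
    have hsymm : ⟪W (adjoint W x.fst), y.snd⟫_ℂ = ⟪x.fst, W (adjoint W y.snd)⟫_ℂ := by
      rw [← adjoint_inner_right, adjoint_inner_left]
    rw [hA, hB, WithLp.prod_inner_apply, WithLp.prod_inner_apply]
    change ⟪adjoint W x.fst, y.fst⟫_ℂ + ⟪x.fst - W (adjoint W x.fst) + W x.snd, y.snd⟫_ℂ =
      ⟪x.fst, W y.fst + (y.snd - W (adjoint W y.snd))⟫_ℂ + ⟪x.snd, adjoint W y.snd⟫_ℂ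
    simp only [inner_add_left, inner_add_right, inner_sub_left, inner_sub_right,
      adjoint_inner_left, adjoint_inner_right, hsymm]
    ring
  refine ⟨A, ?_, fun x => ?_⟩
  · rw [← hAB]
    ext z
    simp [hA, hB, hUU]
  · simp [hA, hW]

variable {Ω : Type*} [MeasurableSpace Ω] {μ : Measure Ω} {E : Type*} [NormedAddCommGroup E]
  [InnerProductSpace ℂ E]

/-- The operator `f ↦ g • (A ∘ f)` on `L²(μ; E)`. -/
def lpMulComp (g : Lp ℂ ∞ μ) (A : E →L[ℂ] E) : Lp E 2 μ →L[ℂ] Lp E 2 μ :=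
  ((lsmul ℂ ℂ : ℂ →L[ℂ] E →L[ℂ] E).holderL μ ∞ 2 2 g) ∘L A.compLpL 2 μ

theorem coeFn_lpMulComp (g : Lp ℂ ∞ μ) (A : E →L[ℂ] E) (f : Lp E 2 μ) :
    lpMulComp g A f =ᵐ[μ] fun t => g t • A (f t) := by
  filter_upwards [(lsmul ℂ ℂ : ℂ →L[ℂ] E →L[ℂ] E).coeFn_holder (r := 2) g (A.compLpL 2 μ f),
    A.coeFn_compLpL (p := 2) (μ := μ) f] with t h₁ h₂
  rw [← h₂]
  exact h₁

theorem adjoint_lpMulComp [CompleteSpace E] {g : Lp ℂ ∞ μ}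
    (hg : ∀ᵐ t ∂μ, (starRingEnd ℂ) (g t) = g t) (A : E →L[ℂ] E) :
    adjoint (lpMulComp g A) = lpMulComp g (adjoint A) := by
  refine ((eq_adjoint_iff _ _).2 fun f h => ?_).symm
  rw [L2.inner_def, L2.inner_def]
  refine integral_congr_ae ?_
  filter_upwards [hg, coeFn_lpMulComp g A h, coeFn_lpMulComp g (adjoint A) f] with t h₀ h₁ h₂
  simp only [h₁, h₂, inner_smul_left, inner_smul_right, adjoint_inner_left, h₀]

theorem normal_lpMulComp [CompleteSpace E] {g : Lp ℂ ∞ μ}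
    (hg : ∀ᵐ t ∂μ, (starRingEnd ℂ) (g t) = g t) {A : E →L[ℂ] E}
    (hA : adjoint A * A = A * adjoint A) :
    adjoint (lpMulComp g A) * lpMulComp g A = lpMulComp g A * adjoint (lpMulComp g A) := by
  rw [adjoint_lpMulComp hg]
  ext1 f
  refine Lp.ext ?_
  filter_upwards [coeFn_lpMulComp g A f, coeFn_lpMulComp g (adjoint A) f,
    coeFn_lpMulComp g A (lpMulComp g (adjoint A) f),
    coeFn_lpMulComp g (adjoint A) (lpMulComp g A f)] with t h₁ h₂ h₃ h₄
  have hAt : adjoint A (A (f t)) = A (adjoint A (f t)) := DFunLike.congr_fun hA (f t)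
  change lpMulComp g (adjoint A) (lpMulComp g A f) t = lpMulComp g A (lpMulComp g (adjoint A) f) t
  rw [h₃, h₄, h₁, h₂, map_smul, map_smul, hAt]

end Normal

section Moments

open MeasureTheory

/-- For `q ≥ 1`, the numbers `(n + 1) / (n + q)` are the ratios of successive moments of a
measure on `[0, 1]`. -/
theorem exists_measure_moment_ratio {q : ℕ} (hq : 1 ≤ q) :
    ∃ μ : Measure ℝ, IsFiniteMeasure μ ∧ (∀ᵐ t ∂μ, t ∈ Set.Icc (0 : ℝ) 1) ∧
      ∀ n : ℕ, 0 < ∫ t, t ^ n ∂μ ∧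
        ((n : ℝ) + 1) * ∫ t, t ^ n ∂μ = ((n : ℝ) + q) * ∫ t, t ^ (n + 1) ∂μ := by
  obtain rfl | ⟨k, rfl⟩ : q = 1 ∨ ∃ k, q = k + 2 := by
    rcases hq.eq_or_lt with h | h
    · exact .inl h.symm
    · exact .inr ⟨q - 2, by omega⟩
  · exact ⟨Measure.dirac 1, inferInstance, by simp [ae_dirac_eq], fun n => by simp⟩
  · have hI (n : ℕ) : IntervalIntegrable (fun t : ℝ => t ^ n * (1 - t) ^ k) volume 0 1 :=
      Continuous.intervalIntegrable (by fun_prop) _ _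
    have hmeas : Measurable fun t : ℝ => ENNReal.ofReal ((1 - t) ^ k) := by fun_prop
    have hint (n : ℕ) : ∫ t, t ^ n ∂(volume.restrict (Set.Ioc (0 : ℝ) 1)).withDensity
        (fun t => ENNReal.ofReal ((1 - t) ^ k)) = ∫ t in (0 : ℝ)..1, t ^ n * (1 - t) ^ k := by
      rw [integral_withDensity_eq_integral_toReal_smul hmeas (by simp),
        intervalIntegral.integral_of_le zero_le_one]
      refine setIntegral_congr_fun measurableSet_Ioc fun t ht => ?_
      have : 0 ≤ (1 - t) ^ k := pow_nonneg (by linarith [ht.2]) _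
      simp [ENNReal.toReal_ofReal this, mul_comm]
    refine ⟨(volume.restrict (Set.Ioc (0 : ℝ) 1)).withDensity
      fun t => ENNReal.ofReal ((1 - t) ^ k), ?_, ?_, fun n => ?_⟩
    · refine isFiniteMeasure_withDensity_ofReal ?_
      have := (hI 0).1
      simp only [pow_zero, one_mul] at this
      exact this.2
    · refine (withDensity_absolutelyContinuous _ _).ae_le ?_
      filter_upwards [ae_restrict_mem measurableSet_Ioc] with t ht using Set.Ioc_subset_Icc_self ht
    · rw [hint, hint]
      constructor
      · refine intervalIntegral.intervalIntegral_pos_of_pos_on (hI n) (fun t ht => ?_) zero_lt_one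
        have : 0 < 1 - t := by linarith [ht.2]
        have := ht.1
        positivity
      · have hFTC : ∫ t in (0 : ℝ)..1, (((n : ℝ) + 1) * (t ^ n * (1 - t) ^ k) -
            ((n : ℝ) + (k + 2 : ℕ)) * (t ^ (n + 1) * (1 - t) ^ k)) =
            (1 : ℝ) ^ (n + 1) * (1 - 1) ^ (k + 1) - 0 ^ (n + 1) * (1 - 0) ^ (k + 1) := by
          refine intervalIntegral.integral_eq_sub_of_hasDerivAt
            (f := fun t : ℝ => t ^ (n + 1) * (1 - t) ^ (k + 1)) (fun t _ => ?_)
            (((hI n).const_mul _).sub ((hI (n + 1)).const_mul _))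
          have h := (hasDerivAt_pow (n + 1) t).mul
            (((hasDerivAt_id t).const_sub 1).fun_pow (k + 1))
          refine h.congr_deriv ?_
          simp only [id, Nat.add_sub_cancel]
          push_cast
          ring
        rw [intervalIntegral.integral_sub ((hI n).const_mul _) ((hI (n + 1)).const_mul _),
          intervalIntegral.integral_const_mul, intervalIntegral.integral_const_mul] at hFTC
        simp only [sub_self, ne_eq, Nat.add_eq_zero_iff, one_ne_zero, and_false,
          not_false_eq_true, zero_pow, mul_zero, zero_mul] at hFTC
        linarith

end Moments

section Shift

variable {V : Type}

theorem inner_evec_left (v : V) (f : l2 V) : ⟪evec v, f⟫_ℂ = f v := by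
  classical
  simp [evec, lp.inner_single_left]

theorem orthonormal_evec : Orthonormal ℂ (evec : V → l2 V) := by
  classical
  rw [orthonormal_iff_ite]
  intro v w
  rw [inner_evec_left]
  simp [evec, lp.single_apply, Pi.single_apply]

theorem l2_clm_ext {E : Type*} [NormedAddCommGroup E] [NormedSpace ℂ E] {A B : l2 V →L[ℂ] E}
    (h : ∀ v, A (evec v) = B (evec v)) : A = B := by
  classical
  refine lp.ext_continuousLinearMap (by simp) fun v => ?_
  ext
  convert h v <;> simp [evec]

/-- An orthonormal family indexed by `V` determines an isometry on `ℓ²(V)`. -/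
theorem Orthonormal.exists_linearIsometry {E : Type*} [NormedAddCommGroup E]
    [InnerProductSpace ℂ E] [CompleteSpace E] {g : V → E} (hg : Orthonormal ℂ g) :
    ∃ J : l2 V →ₗᵢ[ℂ] E, ∀ v, J (evec v) = g v := by
  let := Classical.decEq V
  exact ⟨hg.orthogonalFamily.linearIsometry, fun v =>
    (hg.orthogonalFamily.linearIsometry_apply_single (i := v) (1 : ℂ)).trans (one_smul ℂ (g v))⟩

namespace DirTree

variable (T : DirTree V)

theorem exists_mem_chiIter (v : V) : ∃ n, v ∈ T.chiIter n {T.root} := by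
  induction T.connected T.root v with
  | refl => exact ⟨0, rfl⟩
  | @tail a b _ hab ih =>
    obtain ⟨n, hn⟩ := ih
    rcases hab with h | h
    · exact ⟨n + 1, a, hn, h⟩
    · cases n with
      | zero =>
        obtain rfl : a = T.root := hn
        exact (T.root_no_parent b h).elim
      | succ n =>
        obtain ⟨c, hc, hca⟩ := hn
        exact ⟨n, T.uniq_parent hca h ▸ hc⟩

theorem depth_child {v u : V} (h : T.edge v u) : T.depth u = T.depth v + 1 := by
  have hv : v ∈ T.chiIter (T.depth v) {T.root} := Nat.sInf_mem (T.exists_mem_chiIter v)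
  refine le_antisymm (Nat.sInf_le ⟨v, hv, h⟩) ?_
  refine le_csInf (T.exists_mem_chiIter u) fun n hn => ?_
  cases n with
  | zero =>
    obtain rfl : u = T.root := hn
    exact (T.root_no_parent v h).elim
  | succ n =>
    obtain ⟨c, hc, hcu⟩ := hn
    obtain rfl := T.uniq_parent hcu h
    exact Nat.succ_le_succ (Nat.sInf_le hc)

variable {T} {hT : T.LocFin}

theorem mem_chiFin {v u : V} : u ∈ T.chiFin hT v ↔ T.edge v u := by
  simp [chiFin, chi]

variable (hT) in
/-- The normalized indicator function of the set of children of `v`. -/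
def childVec (v : V) : l2 V :=
  ((Real.sqrt (T.chiFin hT v).card : ℂ))⁻¹ • ∑ u ∈ T.chiFin hT v, evec u

theorem orthonormal_childVec (hL : T.Leafless) : Orthonormal ℂ (T.childVec hT) := by
  classical
  have hsum (v w : V) : ⟪∑ u ∈ T.chiFin hT v, evec u, ∑ u ∈ T.chiFin hT w, evec u⟫_ℂ =
      ((T.chiFin hT v ∩ T.chiFin hT w).card : ℂ) := by
    simp_rw [sum_inner, inner_sum, orthonormal_iff_ite.1 orthonormal_evec]
    simp [Finset.sum_ite_mem]
  rw [orthonormal_iff_ite]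
  intro v w
  rw [childVec, childVec, inner_smul_left, inner_smul_right, hsum]
  split_ifs with h
  · subst h
    obtain ⟨u, hu⟩ := hL v
    have hc : (0 : ℝ) < (T.chiFin hT v).card :=
      Nat.cast_pos.2 (Finset.card_pos.2 ⟨u, mem_chiFin.2 hu⟩)
    have hs := (Real.sqrt_pos.2 hc).ne'
    have hm := Real.mul_self_sqrt hc.le
    rw [Finset.inter_self, map_inv₀, Complex.conj_ofReal]
    norm_cast
    field_simp
    linarith
  · have : T.chiFin hT v ∩ T.chiFin hT w = ∅ := by
      ext u
      simp only [Finset.mem_inter, mem_chiFin, Finset.notMem_empty, iff_false]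
      exact fun hu => h (T.uniq_parent hu.1 hu.2)
    simp [this]

theorem map_childVec {E : Type*} [AddCommGroup E] [Module ℂ E] (A : l2 V →ₗ[ℂ] E) (v : V) :
    A (T.childVec hT v) =
      ((Real.sqrt (T.chiFin hT v).card : ℂ))⁻¹ • ∑ u ∈ T.chiFin hT v, A (evec u) := by
  simp [childVec]

theorem IsDirichletShift.apply_evec {q : ℝ} {S : l2 V →L[ℂ] l2 V}
    (hS : T.IsDirichletShift hT q S) (v : V) :
    S (evec v) = (Real.sqrt (((T.depth v : ℝ) + q) / ((T.depth v : ℝ) + 1)) : ℂ) •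
      T.childVec hT v := by
  rw [hS v, ← Finset.smul_sum, childVec, smul_smul, wt]
  push_cast
  rw [div_eq_mul_inv]

end DirTree

/-- If `S` maps the standard basis to an orthonormal family scaled by factors `a v ≥ 1`, then its
Cauchy dual maps the standard basis to the same family scaled by `(a v)⁻¹`. -/
theorem cauchyDual_evec {S : l2 V →L[ℂ] l2 V} {g : V → l2 V} (hg : Orthonormal ℂ g) {a : V → ℝ}
    (ha : ∀ v, 1 ≤ a v) (hS : ∀ v, S (evec v) = (a v : ℂ) • g v) (v : V) :
    cauchyDual S (evec v) = ((a v)⁻¹ : ℂ) • g v := by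
  classical
  have hev (v : V) : (adjoint S * S) (evec v) = ((a v : ℂ) ^ 2) • evec v := by
    refine lp.ext (funext fun w => ?_)
    rw [← inner_evec_left, ← inner_evec_left]
    change ⟪evec w, adjoint S (S (evec v))⟫_ℂ = _
    rw [adjoint_inner_right, hS, hS, inner_smul_left, inner_smul_right, inner_smul_right,
      orthonormal_iff_ite.1 hg, orthonormal_iff_ite.1 orthonormal_evec]
    split_ifs with h
    · subst h
      simp [sq]
    · simp
  have hcoord (f : l2 V) (v : V) : ((adjoint S * S) f) v = ((a v : ℂ) ^ 2) * f v := by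
    rw [← inner_evec_left, ← inner_evec_left]
    change ⟪evec v, adjoint S (S f)⟫_ℂ = _
    rw [adjoint_inner_right, ← adjoint_inner_left]
    change ⟪(adjoint S * S) (evec v), f⟫_ℂ = _
    rw [hev, inner_smul_left]
    simp
  have hunit : IsUnit (adjoint S * S) := by
    refine isUnit_of_forall_le_norm_inner_map _ (c := 1) one_pos fun f => ?_
    refine le_trans ?_ (RCLike.re_le_norm _)
    have h₁ := (RCLike.hasSum_re ℂ (lp.hasSum_inner f f))
    have h₂ := (RCLike.hasSum_re ℂ (lp.hasSum_inner ((adjoint S * S) f) f))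
    rw [NNReal.coe_one, mul_one, ← inner_self_eq_norm_sq (𝕜 := ℂ)]
    refine hasSum_le (fun v => ?_) h₁ h₂
    have h1 : 1 ≤ (a v) ^ 2 := one_le_pow₀ (ha v)
    have hre : RCLike.re ⟪((adjoint S * S) f) v, f v⟫_ℂ = a v ^ 2 * RCLike.re ⟪f v, f v⟫_ℂ := by
      rw [hcoord f v, ← smul_eq_mul, inner_smul_left, ← Complex.ofReal_pow, Complex.conj_ofReal]
      exact Complex.re_ofReal_mul _ _
    rw [hre]
    exact le_mul_of_one_le_left inner_self_nonneg h1
  have ha0 : (a v : ℂ) ≠ 0 := by exact_mod_cast (zero_lt_one.trans_le (ha v)).ne'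
  have hinv : Ring.inverse (adjoint S * S) (evec v) = (((a v : ℂ) ^ 2)⁻¹) • evec v := by
    have h : (Ring.inverse (adjoint S * S) * (adjoint S * S)) (evec v) = evec v := by
      rw [Ring.inverse_mul_cancel _ hunit]
      rfl
    change Ring.inverse (adjoint S * S) ((adjoint S * S) (evec v)) = evec v at h
    rw [hev, map_smul] at h
    rw [← h, smul_smul, h, inv_mul_cancel₀ (pow_ne_zero 2 ha0), one_smul]
  change S (Ring.inverse (adjoint S * S) (evec v)) = _
  rw [hinv, map_smul, hS, smul_smul]
  congr 1
  field_simp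

end Shift

section Radial

open MeasureTheory

variable {μ : Measure ℝ} [IsFiniteMeasure μ] {E : Type*} [NormedAddCommGroup E]
  [InnerProductSpace ℂ E]

theorem memLp_sqrt_pow_smul (hμ : ∀ᵐ t ∂μ, t ∈ Set.Icc (0 : ℝ) 1) (p : ℝ≥0∞) (n : ℕ) (x : E) :
    MemLp (fun t : ℝ => ((Real.sqrt t : ℂ) ^ n) • x) p μ := by
  refine MemLp.of_bound (Continuous.aestronglyMeasurable (by fun_prop)) ‖x‖ ?_
  filter_upwards [hμ] with t ht
  rw [norm_smul, norm_pow, Complex.norm_real, Real.norm_of_nonneg (Real.sqrt_nonneg t)]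
  exact mul_le_of_le_one_left (norm_nonneg x)
    (pow_le_one₀ (Real.sqrt_nonneg t) (Real.sqrt_le_one.2 ht.2))

/-- The map sending `x` to the function `t ↦ t ^ (n / 2) • x` in `L²(μ; E)`. -/
def sqrtPowLp (hμ : ∀ᵐ t ∂μ, t ∈ Set.Icc (0 : ℝ) 1) (n : ℕ) : E →ₗ[ℂ] Lp E 2 μ where
  toFun x := (memLp_sqrt_pow_smul hμ 2 n x).toLp
  map_add' x y := by
    rw [← MemLp.toLp_add]
    congr 1
    ext t
    simp
  map_smul' c x := by
    rw [← MemLp.toLp_const_smul]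
    congr 1
    ext t
    simp [smul_comm c]

/-- The function `t ↦ √t` in `L^∞(μ)`. -/
def sqrtLinf (hμ : ∀ᵐ t ∂μ, t ∈ Set.Icc (0 : ℝ) 1) : Lp ℂ ∞ μ :=
  (memLp_sqrt_pow_smul hμ ∞ 1 (1 : ℂ)).toLp

variable (hμ : ∀ᵐ t ∂μ, t ∈ Set.Icc (0 : ℝ) 1)

theorem coeFn_sqrtPowLp (n : ℕ) (x : E) :
    sqrtPowLp hμ n x =ᵐ[μ] fun t => ((Real.sqrt t : ℂ) ^ n) • x :=
  (memLp_sqrt_pow_smul hμ 2 n x).coeFn_toLp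

theorem coeFn_sqrtLinf : sqrtLinf hμ =ᵐ[μ] fun t => (Real.sqrt t : ℂ) := by
  filter_upwards [(memLp_sqrt_pow_smul hμ ∞ 1 (1 : ℂ)).coeFn_toLp] with t ht
  rw [sqrtLinf, ht, pow_one, smul_eq_mul, mul_one]

theorem conj_sqrtLinf : ∀ᵐ t ∂μ, (starRingEnd ℂ) (sqrtLinf hμ t) = sqrtLinf hμ t := by
  filter_upwards [coeFn_sqrtLinf hμ] with t ht
  rw [ht, Complex.conj_ofReal]

theorem lpMulComp_sqrtPowLp (A : E →L[ℂ] E) (n : ℕ) (x : E) :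
    lpMulComp (sqrtLinf hμ) A (sqrtPowLp hμ n x) = sqrtPowLp hμ (n + 1) (A x) := by
  refine Lp.ext ?_
  filter_upwards [coeFn_lpMulComp (sqrtLinf hμ) A (sqrtPowLp hμ n x), coeFn_sqrtLinf hμ,
    coeFn_sqrtPowLp hμ n x, coeFn_sqrtPowLp hμ (n + 1) (A x)] with t h₁ h₂ h₃ h₄
  rw [h₁, h₂, h₃, h₄, map_smul, smul_smul, pow_succ']

theorem inner_sqrtPowLp (m n : ℕ) (x y : E) :
    ⟪sqrtPowLp hμ m x, sqrtPowLp hμ n y⟫_ℂ =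
      ((∫ t, Real.sqrt t ^ (m + n) ∂μ : ℝ) : ℂ) * ⟪x, y⟫_ℂ := by
  rw [L2.inner_def, ← integral_complex_ofReal, ← integral_mul_const]
  refine integral_congr_ae ?_
  filter_upwards [coeFn_sqrtPowLp hμ m x, coeFn_sqrtPowLp hμ n y] with t h₁ h₂
  rw [h₁, h₂, inner_smul_left, inner_smul_right, map_pow, Complex.conj_ofReal]
  push_cast
  ring

theorem orthonormal_sqrtPowLp {ι : Type*} {e : ι → E} (he : Orthonormal ℂ e) (d : ι → ℕ)
    (hpos : ∀ n : ℕ, 0 < ∫ t, t ^ n ∂μ) :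
    Orthonormal ℂ fun i =>
      (((Real.sqrt (∫ t, t ^ d i ∂μ))⁻¹ : ℝ) : ℂ) • sqrtPowLp hμ (d i) (e i) := by
  classical
  rw [orthonormal_iff_ite]
  intro i j
  rw [inner_smul_left, inner_smul_right, inner_sqrtPowLp, orthonormal_iff_ite.1 he]
  split_ifs with h
  · subst h
    have hmom : ∫ t, Real.sqrt t ^ (d i + d i) ∂μ = ∫ t, t ^ d i ∂μ := by
      refine integral_congr_ae ?_
      filter_upwards [hμ] with t ht
      rw [← two_mul, pow_mul, Real.sq_sqrt ht.1]
    have hs := (Real.sqrt_pos.2 (hpos (d i))).ne'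
    have hm := Real.mul_self_sqrt (hpos (d i)).le
    rw [hmom, Complex.conj_ofReal]
    norm_cast
    nth_rewrite 3 [← hm]
    field_simp
  · simp

end Radial

theorem stmt_10 {V : Type} [Countable V] [Infinite V] (T : DirTree V)
    (hL : T.Leafless) (hT : T.LocFin) (q : ℕ) (hq : 1 ≤ q)
    (S : l2 V →L[ℂ] l2 V) (hS : T.IsDirichletShift hT (q : ℝ) S) :
    ∃ (K : Type) (_ : NormedAddCommGroup K) (_ : InnerProductSpace ℂ K)
      (_ : CompleteSpace K) (J : l2 V →ₗᵢ[ℂ] K) (N : K →L[ℂ] K),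
      ContinuousLinearMap.adjoint N * N = N * ContinuousLinearMap.adjoint N ∧
        ∀ f : l2 V, N (J f) = J (cauchyDual S f) := by
  obtain ⟨μ, _, hμ, hmom⟩ := exists_measure_moment_ratio hq
  obtain ⟨U, hU⟩ := (DirTree.orthonormal_childVec (hT := hT) hL).exists_linearIsometry
  obtain ⟨A, hA, hAU⟩ := U.exists_normal_extension
  let ι : l2 V →ₗᵢ[ℂ] WithLp 2 (l2 V × l2 V) :=
    { toFun := fun x => WithLp.toLp 2 (x, 0)
      map_add' := fun x y => by simp [← WithLp.toLp_add]
      map_smul' := fun c x => by simp [← WithLp.toLp_smul]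
      norm_map' := fun x => by simp }
  have hι : Orthonormal ℂ fun v : V => ι (evec v) := orthonormal_evec.comp_linearIsometry ι
  obtain ⟨J, hJ⟩ :=
    (orthonormal_sqrtPowLp hμ hι T.depth fun n => (hmom n).1).exists_linearIsometry
  refine ⟨MeasureTheory.Lp (WithLp 2 (l2 V × l2 V)) 2 μ, inferInstance, inferInstance, inferInstance, J,
    lpMulComp (sqrtLinf hμ) A, normal_lpMulComp (conj_sqrtLinf hμ) hA, fun f => ?_⟩
  suffices h : lpMulComp (sqrtLinf hμ) A ∘L J.toContinuousLinearMap =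
      J.toContinuousLinearMap ∘L cauchyDual S from DFunLike.congr_fun h f
  refine l2_clm_ext fun v => ?_
  change lpMulComp (sqrtLinf hμ) A (J (evec v)) = J (cauchyDual S (evec v))
  have hJchild : J (T.childVec hT v) =
      (((Real.sqrt (∫ t, t ^ (T.depth v + 1) ∂μ))⁻¹ : ℝ) : ℂ) •
        sqrtPowLp hμ (T.depth v + 1) (ι (T.childVec hT v)) := by
    have h₁ := DirTree.map_childVec (hT := hT) J.toLinearMap v
    have h₂ := DirTree.map_childVec (hT := hT) (sqrtPowLp hμ (T.depth v + 1) ∘ₗ ι.toLinearMap) v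
    simp only [LinearMap.comp_apply, LinearIsometry.coe_toLinearMap] at h₁ h₂
    rw [h₁, h₂, smul_comm]
    congr 1
    rw [Finset.smul_sum]
    refine Finset.sum_congr rfl fun u hu => ?_
    rw [hJ, T.depth_child (DirTree.mem_chiFin.1 hu)]
  have hq' : (1 : ℝ) ≤ q := by exact_mod_cast hq
  have ha (v : V) : 1 ≤ Real.sqrt (((T.depth v : ℝ) + q) / ((T.depth v : ℝ) + 1)) := by
    rw [Real.one_le_sqrt, one_le_div (by positivity)]
    linarith
  rw [cauchyDual_evec (DirTree.orthonormal_childVec hL) ha hS.apply_evec, map_smul,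
    hJchild, hJ, map_smul, lpMulComp_sqrtPowLp, smul_smul]
  have hAι : A (ι (evec v)) = ι (T.childVec hT v) := by
    rw [← hU]
    exact hAU _
  rw [hAι]
  congr 1
  obtain ⟨hpos, hrec⟩ := hmom (T.depth v)
  have hpos' := (hmom (T.depth v + 1)).1
  have hd : (0 : ℝ) < (T.depth v : ℝ) + 1 := by positivity
  have hratio : ∫ t, t ^ T.depth v ∂μ = ((T.depth v : ℝ) + q) / ((T.depth v : ℝ) + 1) *
      ∫ t, t ^ (T.depth v + 1) ∂μ := by
    field_simp
    linarith
  rw [hratio, Real.sqrt_mul (by positivity), mul_inv]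
  push_cast
  ring

end
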